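/- Let G = (V, E, s) be a graph in which every node is reachable from s and with |V| ≥ 2. Then the nesting width of G satisfies nw(G) = 1 + max{ |S^a_i| : a ∈ V, 1 ≤ i ≤ k_a }; in particular, the A-C family AC is a nesting decomposition of G of minimum width. -/

import Mathlib

open Relation

variable {V : Type*}

/-- `p` is a path from `a` to `b` in the arc relation `E`:
a nonempty list of nodes starting at `a`, ending at `b`,
in which every consecutive pair of nodes is an arc. -/
def IsPath (E : V → V → Prop) (a b : V) (p : List V) : Prop :=
  p ≠ [] ∧ p.head? = some a ∧ p.getLast? = some b ∧ p.Chain' E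

/-- `a` dominates `b` (written `a ≥_s b`): every path from `s` to `b` contains `a`. -/
def Dom (E : V → V → Prop) (s a b : V) : Prop :=
  ∀ p : List V, IsPath E s b p → a ∈ p

/-- `m` is a source of module `M`: `m ∈ M`, every arc entering `M` from outside goes
to `m`, and (convention) if `s ∈ M` then `m = s`. -/
def ModuleSource (E : V → V → Prop) (s : V) (M : Set V) (m : V) : Prop :=
  m ∈ M ∧ (∀ u v, E u v → u ∉ M → v ∈ M → v = m) ∧ (s ∈ M → m = s)

/-- `M` is a module of the graph `(V, E, s)`. -/
def IsModule (E : V → V → Prop) (s : V) (M : Set V) : Prop :=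
  ∃ m, ModuleSource E s M m

/-- Two sets overlap: they intersect but neither contains the other. -/
def Overlap (M H : Set V) : Prop :=
  (M ∩ H).Nonempty ∧ ¬ M ⊆ H ∧ ¬ H ⊆ M

/-- A nesting decomposition: a collection of pairwise non-overlapping modules
containing the trivial modules (the whole node set and all singletons). -/
def IsNestingDecomp (E : V → V → Prop) (s : V) (F : Set (Set V)) : Prop :=
  (∀ M ∈ F, IsModule E s M) ∧
  (∀ M ∈ F, ∀ H ∈ F, ¬ Overlap M H) ∧
  (Set.univ : Set V) ∈ F ∧
  (∀ v : V, ({v} : Set V) ∈ F)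

/-- The maximal module partition of `M` within the family `F`. -/
def MaxPartition (F : Set (Set V)) (M : Set V) : Set (Set V) :=
  {H | H ∈ F ∧ H ⊂ M ∧ ¬ ∃ K ∈ F, H ⊂ K ∧ K ⊂ M}

/-- The width of a nesting decomposition `F`. -/
noncomputable def NDWidth (F : Set (Set V)) : ℕ :=
  ⨆ M ∈ F, (MaxPartition F M).ncard

/-- The nesting width of the graph `(V, E, s)`. -/
noncomputable def nestingWidth (E : V → V → Prop) (s : V) : ℕ :=
  sInf {w : ℕ | ∃ F : Set (Set V), IsNestingDecomp E s F ∧ NDWidth F = w}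

/-- `D(a)`: the set of nodes dominated by `a`. -/
def DomSet (E : V → V → Prop) (s a : V) : Set V := {v | Dom E s a v}

/-- `v` is a child of `a` in the dominator tree. -/
def IsChild (E : V → V → Prop) (s a v : V) : Prop :=
  v ≠ a ∧ Dom E s a v ∧ ∀ b, b ≠ a → b ≠ v → ¬(Dom E s a b ∧ Dom E s b v)

/-- `C(a)`: the set of children of `a` in the dominator tree. -/
def Children (E : V → V → Prop) (s a : V) : Set V := {v | IsChild E s a v}

/-- The arc relation of the graph `G_a` on the children of `a`. -/
def GArc (E : V → V → Prop) (s a : V) (u v : V) : Prop :=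
  u ∈ Children E s a ∧ v ∈ Children E s a ∧ u ≠ v ∧
    ∃ x y, E x y ∧ x ∈ DomSet E s u ∧ y ∈ DomSet E s v

/-- `S` is a strongly connected component of `G_a`
(an equivalence class of mutual reachability in `G_a`). -/
def IsSCC (E : V → V → Prop) (s a : V) (S : Set V) : Prop :=
  ∃ u ∈ Children E s a,
    S = {v | v ∈ Children E s a ∧ ReflTransGen (GArc E s a) u v ∧
          ReflTransGen (GArc E s a) v u}

/-- `L` lists the strongly connected components of `G_a` in topological order:
each member is an SCC of `G_a`, every child of `a` lies in exactly one listed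
component, and every arc of `G_a` goes from an earlier component to the same
or a later component. -/
def IsTopoSCCList (E : V → V → Prop) (s a : V) (L : List (Set V)) : Prop :=
  (∀ S ∈ L, IsSCC E s a S) ∧
  (∀ v ∈ Children E s a, ∃! i : Fin L.length, v ∈ L.get i) ∧
  (∀ i j : Fin L.length, ∀ u ∈ L.get i, ∀ v ∈ L.get j, GArc E s a u v → i ≤ j)

/-- `D(S) = ⋃_{v ∈ S} D(v)`. -/
def DSet (E : V → V → Prop) (s : V) (S : Set V) : Set V := ⋃ v ∈ S, DomSet E s v

/-- The set `{a} ∪ ⋃_{i=1}^{j} D(S^a_i)` (components indexed from 0 in the list). -/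
def PrefixModule (E : V → V → Prop) (s a : V) (L : List (Set V)) (j : ℕ) : Set V :=
  {a} ∪ ⋃ i ∈ Finset.range j, DSet E s (L.getD i ∅)

/-- The A-C family determined by a choice `L` of topologically ordered SCC lists. -/
def ACFamily (E : V → V → Prop) (s : V) (L : V → List (Set V)) : Set (Set V) :=
  {M | ∃ (a : V) (j : ℕ), j ≤ (L a).length ∧ M = PrefixModule E s a (L a) j}

/-- The quantity `max { |S^a_i| : a ∈ V, 1 ≤ i ≤ k_a }`. -/
noncomputable def MaxSCCSize (L : V → List (Set V)) : ℕ :=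
  ⨆ a : V, ⨆ i ∈ Finset.range (L a).length, ((L a).getD i ∅).ncard

namespace IsPath

variable {E : V → V → Prop} {s u v : V} {p : List V}

theorem singleton (E : V → V → Prop) (s : V) : IsPath E s s [s] :=
  ⟨by simp, rfl, rfl, List.isChain_singleton s⟩

theorem concat (h : IsPath E s u p) (huv : E u v) : IsPath E s v (p ++ [v]) := by
  obtain ⟨h₁, h₂, h₃, h₄⟩ := h
  refine ⟨by simp, by simp [List.head?_append, h₂], by simp, ?_⟩
  refine List.isChain_append.2 ⟨h₄, by simp, ?_⟩
  intro x hx y hy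
  simp_all

/-- Induction along the prefixes of a path. -/
theorem induction {P : V → Prop} (h : IsPath E s v p) (hs : s ∈ p → P s)
    (hstep : ∀ x y, E x y → y ∈ p → P x → P y) : P v := by
  induction p using List.reverseRecOn generalizing v with
  | nil => exact absurd rfl h.1
  | append_singleton q w ih =>
    obtain ⟨-, h₂, h₃, h₄⟩ := h
    obtain rfl : w = v := by simpa using h₃
    rcases List.eq_nil_or_concat q with rfl | ⟨q', u, rfl⟩
    · obtain rfl : w = s := by simpa using h₂
      exact hs (by simp)
    · have h₅ := List.isChain_append.1 h₄
      refine hstep u w (h₅.2.2 u (by simp) w (by simp)) (by simp) ?_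
      refine ih ⟨by simp, ?_, by simp, h₅.1⟩ (fun hm => hs (List.mem_append_left _ hm))
        (fun x y hxy hy => hstep x y hxy (List.mem_append_left _ hy))
      rw [List.head?_append] at h₂
      simpa using h₂

end IsPath

section Dominance

variable {E : V → V → Prop} {s a b c u v w x y m : V} {M : Set V}

theorem reach_induction {P : V → Prop} (hreach : ∀ v : V, ∃ p : List V, IsPath E s v p)
    (hs : P s) (hstep : ∀ x y, E x y → P x → P y) (v : V) : P v := by
  obtain ⟨p, hp⟩ := hreach v
  exact hp.induction (fun _ => hs) fun x y hxy _ => hstep x y hxy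

theorem Dom.refl (E : V → V → Prop) (s a : V) : Dom E s a a :=
  fun _ h => List.mem_of_getLast? h.2.2.1

theorem Dom.source_left (E : V → V → Prop) (s a : V) : Dom E s s a :=
  fun _ h => List.mem_of_head? h.2.1

theorem Dom.eq_source (h : Dom E s a s) : a = s := by
  simpa using h [s] (IsPath.singleton E s)

theorem Dom.of_arc (h : Dom E s a y) (hxy : E x y) (hne : y ≠ a) : Dom E s a x := by
  intro p hp
  have := h _ (hp.concat hxy)
  simp only [List.mem_append, List.mem_singleton] at this
  exact this.resolve_right fun e => hne e.symm

theorem not_dom_induction {P : V → Prop} (h : ¬ Dom E s a v) (hs : s ≠ a → P s)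
    (hstep : ∀ x y, E x y → y ≠ a → ¬ Dom E s a x → P x → P y) : P v := by
  simp only [Dom, not_forall] at h
  obtain ⟨p, hp, ha⟩ := h
  have key : ¬ Dom E s a v ∧ P v := by
    refine hp.induction (P := fun z => ¬ Dom E s a z ∧ P z) ?_ ?_
    · intro hsp
      have hne : s ≠ a := fun e => ha (e ▸ hsp)
      exact ⟨fun hd => hne hd.eq_source.symm, hs hne⟩
    · rintro x y hxy hy ⟨h₁, h₂⟩
      have hne : y ≠ a := fun e => ha (e ▸ hy)
      exact ⟨fun hd => h₁ (hd.of_arc hxy hne), hstep x y hxy hne h₁ h₂⟩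
  exact key.2

theorem Dom.trans (hab : Dom E s a b) (hbc : Dom E s b c) : Dom E s a c := by
  by_contra hac
  refine not_dom_induction (P := fun z => ¬ Dom E s b z) hac ?_ ?_ hbc
  · intro hne hbs
    obtain rfl := hbs.eq_source
    exact hne hab.eq_source.symm
  · intro x y hxy hya hax hbx hby
    refine hbx (hby.of_arc hxy ?_)
    rintro rfl
    exact hax (hab.of_arc hxy hya)

theorem Dom.antisymm (hreach : ∀ v : V, ∃ p : List V, IsPath E s v p)
    (hab : Dom E s a b) (hba : Dom E s b a) : a = b := by
  by_contra hne
  have key : ¬ Dom E s a a ∧ ¬ Dom E s b a := by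
    refine reach_induction (P := fun z => ¬ Dom E s a z ∧ ¬ Dom E s b z) hreach ?_ ?_ a
    · constructor
      · intro h
        obtain rfl := h.eq_source
        exact hne hba.eq_source.symm
      · intro h
        obtain rfl := h.eq_source
        exact hne hab.eq_source
    · rintro x y hxy ⟨hax, hbx⟩
      constructor
      · intro h
        by_cases hy : y = a
        · subst hy
          exact hbx (hba.of_arc hxy hne)
        · exact hax (h.of_arc hxy hy)
      · intro h
        by_cases hy : y = b
        · subst hy
          exact hax (hab.of_arc hxy (Ne.symm hne))
        · exact hbx (h.of_arc hxy hy)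
  exact key.2 hba

/-- The dominators of a node form a chain. -/
theorem Dom.total (hreach : ∀ v : V, ∃ p : List V, IsPath E s v p)
    (ha : Dom E s a v) (hb : Dom E s b v) : Dom E s a b ∨ Dom E s b a := by
  by_contra! h
  have hne : a ≠ b := by
    rintro rfl
    exact h.1 (Dom.refl E s a)
  have key : ¬ (Dom E s a v ∧ Dom E s b v) := by
    refine reach_induction (P := fun z => ¬ (Dom E s a z ∧ Dom E s b z)) hreach ?_ ?_ v
    · rintro ⟨h₁, h₂⟩
      exact hne (h₁.eq_source.trans h₂.eq_source.symm)
    · rintro x y hxy hx ⟨h₁, h₂⟩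
      refine hx ⟨h₁.of_arc hxy ?_, h₂.of_arc hxy ?_⟩
      · rintro rfl
        exact h.2 h₂
      · rintro rfl
        exact h.1 h₁
  exact key ⟨ha, hb⟩

theorem ModuleSource.dom (hM : ModuleSource E s M m) (hv : v ∈ M) : Dom E s m v := by
  by_contra h
  refine not_dom_induction (P := fun z => z ∉ M) h ?_ ?_ hv
  · exact fun hne hs => hne (hM.2.2 hs).symm
  · exact fun x y hxy hy _ hx hyM => hy (hM.2.1 x y hxy hx hyM)

/-- Modules are convex for dominance. -/
theorem ModuleSource.mem_of_dom (hreach : ∀ v : V, ∃ p : List V, IsPath E s v p)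
    (hM : ModuleSource E s M m) (hmb : Dom E s m b) (hbv : Dom E s b v) (hv : v ∈ M) :
    b ∈ M := by
  by_contra hb
  refine reach_induction (P := fun z => z ∈ M → ¬ Dom E s b z) hreach ?_ ?_ v hv hbv
  · intro hs h
    exact hb (h.eq_source ▸ hs)
  · intro x y hxy hx hy h
    have hyb : y ≠ b := fun e => hb (e ▸ hy)
    by_cases hxM : x ∈ M
    · exact hx hxM (h.of_arc hxy hyb)
    · obtain rfl := hM.2.1 x y hxy hxM hy
      exact hyb (hmb.antisymm hreach h)

theorem IsChild.eq_of_dom (hreach : ∀ v : V, ∃ p : List V, IsPath E s v p)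
    (hv : IsChild E s a v) (hw : IsChild E s a w) (hvx : Dom E s v x) (hwx : Dom E s w x) :
    v = w := by
  by_contra hne
  rcases hvx.total hreach hwx with h | h
  · exact hw.2.2 v hv.1 hne ⟨hv.2.1, h⟩
  · exact hv.2.2 w hw.1 (Ne.symm hne) ⟨hw.2.1, h⟩

theorem IsChild.not_dom_parent (hreach : ∀ v : V, ∃ p : List V, IsPath E s v p)
    (hv : IsChild E s a v) : ¬ Dom E s v a :=
  fun h => hv.1 (h.antisymm hreach hv.2.1)

theorem IsChild.dom_of_dom (hreach : ∀ v : V, ∃ p : List V, IsPath E s v p)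
    (hv : IsChild E s a v) (hbv : Dom E s b v) (hne : b ≠ v) : Dom E s b a := by
  rcases hbv.total hreach hv.2.1 with h | h
  · exact h
  · by_cases hb : b = a
    · exact hb ▸ Dom.refl E s b
    · exact absurd ⟨h, hbv⟩ (hv.2.2 b hb hne)

theorem exists_child_dom [Finite V] (hreach : ∀ v : V, ∃ p : List V, IsPath E s v p)
    (hau : Dom E s a u) (hne : u ≠ a) : ∃ w, IsChild E s a w ∧ Dom E s w u := by
  obtain ⟨w, ⟨hwa, haw, hwu⟩, hmax⟩ := Set.exists_max_image
    {w | w ≠ a ∧ Dom E s a w ∧ Dom E s w u} (fun w => (DomSet E s w).ncard)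
    (Set.toFinite _) ⟨u, hne, hau, Dom.refl E s u⟩
  refine ⟨w, ⟨hwa, haw, ?_⟩, hwu⟩
  rintro b hba hbw ⟨hab, hbw'⟩
  refine (hmax b ⟨hba, hab, hbw'.trans hwu⟩).not_gt (Set.ncard_lt_ncard ?_ (Set.toFinite _))
  refine ⟨fun z hz => hbw'.trans hz, fun h => hbw ?_⟩
  exact hbw'.antisymm hreach (h (Dom.refl E s b))

/-- A module containing two distinct children of `a` contains `a`. -/
theorem IsModule.mem_parent (hreach : ∀ v : V, ∃ p : List V, IsPath E s v p)
    (hM : IsModule E s M) (hv : IsChild E s a v) (hw : IsChild E s a w) (hne : v ≠ w)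
    (hvM : v ∈ M) (hwM : w ∈ M) : a ∈ M := by
  obtain ⟨m, hm⟩ := hM
  have hmv := hm.dom hvM
  have hmw := hm.dom hwM
  have hma : Dom E s m a := by
    refine hv.dom_of_dom hreach hmv ?_
    rintro rfl
    exact hne (hv.eq_of_dom hreach hw hmw (Dom.refl E s w))
  exact hm.mem_of_dom hreach hma hv.2.1 hvM

theorem IsModule.mem_of_gArc (hreach : ∀ v : V, ∃ p : List V, IsPath E s v p)
    (hM : IsModule E s M) (ha : a ∈ M) (huv : GArc E s a u v) (hv : v ∈ M) : u ∈ M := by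
  obtain ⟨m, hm⟩ := hM
  obtain ⟨hu, hv', hne, x, y, hxy, hux, hvy⟩ := huv
  have hma := hm.dom ha
  have hyv : y = v := by
    by_contra h
    exact hne (hu.eq_of_dom hreach hv' hux (Dom.of_arc hvy hxy h))
  subst hyv
  have hxM : x ∈ M := by
    by_contra hx
    obtain rfl := hm.2.1 x y hxy hx hv
    exact hv'.not_dom_parent hreach hma
  exact hm.mem_of_dom hreach (hma.trans hu.2.1) hux hxM

theorem IsModule.mem_of_reflTransGen (hreach : ∀ v : V, ∃ p : List V, IsPath E s v p)
    (hM : IsModule E s M) (ha : a ∈ M) (huv : ReflTransGen (GArc E s a) u v) (hv : v ∈ M) :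
    u ∈ M := by
  induction huv using ReflTransGen.head_induction_on with
  | refl => exact hv
  | head h _ ih => exact hM.mem_of_gArc hreach ha h ih

/-- A module containing `a` and meeting a strongly connected component of `G_a` contains it. -/
theorem IsModule.subset_of_isSCC (hreach : ∀ v : V, ∃ p : List V, IsPath E s v p)
    (hM : IsModule E s M) (ha : a ∈ M) {S : Set V} (hS : IsSCC E s a S) (hv : v ∈ S)
    (hvM : v ∈ M) : S ⊆ M := by
  obtain ⟨u, -, rfl⟩ := hS
  exact fun w hw => hM.mem_of_reflTransGen hreach ha (hw.2.2.trans hv.2.1) hvM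

end Dominance

section Width

variable {E : V → V → Prop} {s a : V} {F : Set (Set V)}

theorem ncard_maxPartition_le_NDWidth [Finite V] {M : Set V} (hM : M ∈ F) :
    (MaxPartition F M).ncard ≤ NDWidth F :=
  le_ciSup_of_le (Set.finite_range _).bddAbove M
    (le_ciSup_of_le (Set.finite_range _).bddAbove hM le_rfl)

theorem exists_mem_maxPartition [Finite V] {H M : Set V} (hH : H ∈ F) (hHM : H ⊂ M) :
    ∃ K ∈ MaxPartition F M, H ⊆ K := by
  obtain ⟨K, hHK, hK⟩ := Set.Finite.exists_le_maximal
    (Set.toFinite {K : Set V | K ∈ F ∧ K ⊂ M}) (show H ∈ _ from ⟨hH, hHM⟩)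
  refine ⟨K, ⟨hK.prop.1, hK.prop.2, ?_⟩, hHK⟩
  rintro ⟨K', hK'F, hKK', hK'M⟩
  exact hKK'.2 (hK.2 ⟨hK'F, hK'M⟩ hKK'.1)

theorem one_le_NDWidth [Finite V] [Nontrivial V] (hF : IsNestingDecomp E s F) :
    1 ≤ NDWidth F := by
  refine le_trans ?_ (ncard_maxPartition_le_NDWidth hF.2.2.1)
  have hs : ({s} : Set V) ⊂ Set.univ := by
    rw [Set.ssubset_univ_iff]
    exact Set.singleton_ne_univ s
  obtain ⟨K, hK, -⟩ := exists_mem_maxPartition (hF.2.2.2 s) hs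
  exact (Set.ncard_pos (Set.toFinite _)).2 ⟨K, hK⟩

/-- A strongly connected component of `G_a` and `a` itself are separated by the maximal module
partition of some module of any nesting decomposition. -/
theorem one_add_ncard_le_NDWidth [Finite V] (hreach : ∀ v : V, ∃ p : List V, IsPath E s v p)
    (hF : IsNestingDecomp E s F) {S : Set V} (hS : IsSCC E s a S) :
    1 + S.ncard ≤ NDWidth F := by
  have hchild : ∀ v ∈ S, IsChild E s a v := by
    obtain ⟨u, -, rfl⟩ := hS
    exact fun v hv => hv.1
  obtain ⟨v₀, hv₀⟩ : S.Nonempty := by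
    obtain ⟨u, hu, rfl⟩ := hS
    exact ⟨u, hu, .refl, .refl⟩
  obtain ⟨M, hM⟩ := Set.Finite.exists_minimal
    (Set.toFinite {M : Set V | M ∈ F ∧ a ∈ M ∧ ∃ v ∈ S, v ∈ M})
    ⟨Set.univ, hF.2.2.1, trivial, v₀, hv₀, trivial⟩
  obtain ⟨⟨hMF, haM, v, hvS, hvM⟩, hmin⟩ := hM
  have hSM : S ⊆ M := (hF.1 M hMF).subset_of_isSCC hreach haM hS hvS hvM
  have haS : a ∉ S := fun h => (hchild a h).1 rfl
  have hsub : insert a S ⊆ M := Set.insert_subset haM hSM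
  have hpart : ∀ x ∈ insert a S, ∃ K ∈ MaxPartition F M, x ∈ K := by
    intro x hx
    have hxM : ({x} : Set V) ⊂ M := by
      refine ⟨Set.singleton_subset_iff.2 (hsub hx), fun h => (hchild v hvS).1 ?_⟩
      exact (h hvM : v = x).trans (h haM : a = x).symm
    obtain ⟨K, hK, hxK⟩ := exists_mem_maxPartition (hF.2.2.2 x) hxM
    exact ⟨K, hK, hxK rfl⟩
  choose! f hf hxf using hpart
  have hsep : ∀ K ∈ MaxPartition F M, a ∈ K → ∀ w ∈ S, w ∉ K := by
    intro K hK haK w hw hwK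
    exact hK.2.1.2 (hmin ⟨hK.1, haK, w, hw, hwK⟩ hK.2.1.1)
  have hinj : Set.InjOn f (insert a S) := by
    intro x hx y hy hxy
    have hxK := hxf x hx
    have hyK : y ∈ f x := hxy ▸ hxf y hy
    have hK := hf x hx
    rcases hx with rfl | hx <;> rcases hy with rfl | hy
    · rfl
    · exact absurd hyK (hsep _ hK hxK y hy)
    · exact absurd hxK (hsep _ hK hyK x hx)
    · by_contra hne
      exact hsep _ hK ((hF.1 _ hK.1).mem_parent hreach (hchild x hx) (hchild y hy) hne hxK hyK)
        x hx hxK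
  calc 1 + S.ncard = (insert a S).ncard := by
        rw [Set.ncard_insert_of_notMem haS (Set.toFinite _), add_comm]
    _ ≤ (MaxPartition F M).ncard := Set.ncard_le_ncard_of_injOn f hf hinj (Set.toFinite _)
    _ ≤ NDWidth F := ncard_maxPartition_le_NDWidth hMF

end Width

section PrefixModule

variable {E : V → V → Prop} {s a b v w x : V} {l l' : List (Set V)} {i j k : ℕ}

theorem IsTopoSCCList.isSCC_getD (hl : IsTopoSCCList E s a l) (hi : i < l.length) :
    IsSCC E s a (l.getD i ∅) := by
  rw [List.getD_eq_getElem _ _ hi]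
  exact hl.1 _ (List.getElem_mem hi)

theorem mem_getD_empty_iff : v ∈ l.getD i ∅ ↔ ∃ hi : i < l.length, v ∈ l[i] := by
  by_cases hi : i < l.length
  · simp [hi]
  · simp [hi]

theorem IsTopoSCCList.isChild (hl : IsTopoSCCList E s a l) (hv : v ∈ l.getD i ∅) :
    IsChild E s a v := by
  obtain ⟨hi, -⟩ := mem_getD_empty_iff.1 hv
  obtain ⟨u, -, hu⟩ := hl.isSCC_getD hi
  exact (hu ▸ hv).1

theorem IsTopoSCCList.exists_mem_getD (hl : IsTopoSCCList E s a l) (hv : IsChild E s a v) :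
    ∃ i < l.length, v ∈ l.getD i ∅ := by
  obtain ⟨i, hi, -⟩ := hl.2.1 v hv
  exact ⟨i, i.2, mem_getD_empty_iff.2 ⟨i.2, hi⟩⟩

theorem IsTopoSCCList.index_unique (hl : IsTopoSCCList E s a l) (hi : v ∈ l.getD i ∅)
    (hj : v ∈ l.getD j ∅) : i = j := by
  have hv := hl.isChild hi
  obtain ⟨hi, hvi⟩ := mem_getD_empty_iff.1 hi
  obtain ⟨hj, hvj⟩ := mem_getD_empty_iff.1 hj
  have := (hl.2.1 v hv).unique (y₁ := ⟨i, hi⟩) (y₂ := ⟨j, hj⟩) hvi hvj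
  simpa using this

theorem IsTopoSCCList.index_le (hl : IsTopoSCCList E s a l) (hi : v ∈ l.getD i ∅)
    (hj : w ∈ l.getD j ∅) (hvw : GArc E s a v w) : i ≤ j := by
  obtain ⟨hi, hvi⟩ := mem_getD_empty_iff.1 hi
  obtain ⟨hj, hwj⟩ := mem_getD_empty_iff.1 hj
  exact hl.2.2 ⟨i, hi⟩ ⟨j, hj⟩ v hvi w hwj hvw

theorem mem_prefixModule : x ∈ PrefixModule E s a l j ↔
    x = a ∨ ∃ i < j, ∃ w ∈ l.getD i ∅, Dom E s w x := by
  simp only [PrefixModule, DSet, DomSet, Set.mem_union, Set.mem_singleton_iff, Set.mem_iUnion,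
    Finset.mem_range, Set.mem_ofPred_eq, exists_prop]

theorem source_mem_prefixModule : a ∈ PrefixModule E s a l j :=
  mem_prefixModule.2 (.inl rfl)

theorem prefixModule_mono (h : j ≤ k) : PrefixModule E s a l j ⊆ PrefixModule E s a l k := by
  intro x hx
  rw [mem_prefixModule] at hx ⊢
  exact hx.imp_right fun ⟨i, hi, hw⟩ => ⟨i, hi.trans_le h, hw⟩

theorem prefixModule_zero : PrefixModule E s a l 0 = {a} := by
  ext x
  simp [mem_prefixModule]

theorem IsTopoSCCList.prefixModule_subset_domSet (hl : IsTopoSCCList E s a l) :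
    PrefixModule E s a l j ⊆ DomSet E s a := by
  intro x hx
  rcases mem_prefixModule.1 hx with rfl | ⟨i, -, w, hw, hwx⟩
  · exact Dom.refl E s x
  · exact (hl.isChild hw).2.1.trans hwx

theorem IsTopoSCCList.prefixModule_length [Finite V]
    (hreach : ∀ v : V, ∃ p : List V, IsPath E s v p) (hl : IsTopoSCCList E s a l) :
    PrefixModule E s a l l.length = DomSet E s a := by
  refine hl.prefixModule_subset_domSet.antisymm fun x hx => mem_prefixModule.2 ?_
  by_cases hxa : x = a
  · exact .inl hxa
  · obtain ⟨w, hw, hwx⟩ := exists_child_dom hreach hx hxa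
    obtain ⟨i, hi, hwi⟩ := hl.exists_mem_getD hw
    exact .inr ⟨i, hi, w, hwi, hwx⟩

theorem IsTopoSCCList.isModule_prefixModule [Finite V]
    (hreach : ∀ v : V, ∃ p : List V, IsPath E s v p) (hl : IsTopoSCCList E s a l) :
    IsModule E s (PrefixModule E s a l j) := by
  refine ⟨a, source_mem_prefixModule, ?_, fun hs => (hl.prefixModule_subset_domSet hs).eq_source⟩
  intro x y hxy hx hy
  rcases mem_prefixModule.1 hy with rfl | ⟨i, hi, w, hw, hwy⟩
  · rfl
  by_contra hya
  refine hx (mem_prefixModule.2 ?_)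
  by_cases hyw : y = w
  · subst hyw
    have hwa := hl.isChild hw
    by_cases hxa : x = a
    · exact .inl hxa
    obtain ⟨w', hw', hwx'⟩ := exists_child_dom hreach (hwa.2.1.of_arc hxy hya) hxa
    obtain ⟨i', -, hwi'⟩ := hl.exists_mem_getD hw'
    by_cases hww : w' = y
    · exact .inr ⟨i, hi, y, hw, hww ▸ hwx'⟩
    · exact .inr ⟨i', (hl.index_le hwi' hw ⟨hw', hwa, hww, x, y, hxy, hwx', hwy⟩).trans_lt hi,
        w', hwi', hwx'⟩
  · exact .inr ⟨i, hi, w, hw, hwy.of_arc hxy hyw⟩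

/-- A node of `D(v)`, with `v` a child of `a` in the `i`-th component, lies only in the prefixes
that include the `i`-th component. -/
theorem IsTopoSCCList.lt_of_mem_prefixModule (hreach : ∀ v : V, ∃ p : List V, IsPath E s v p)
    (hl : IsTopoSCCList E s a l) (hv : v ∈ l.getD i ∅) (hvx : Dom E s v x)
    (hx : x ∈ PrefixModule E s a l j) : i < j := by
  rcases mem_prefixModule.1 hx with rfl | ⟨i', hi', w, hw, hwx⟩
  · exact absurd hvx ((hl.isChild hv).not_dom_parent hreach)
  · obtain rfl := (hl.isChild hv).eq_of_dom hreach (hl.isChild hw) hvx hwx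
    exact hl.index_unique hv hw ▸ hi'

theorem domSet_subset_prefixModule (hv : v ∈ l.getD i ∅) (hij : i < j) :
    DomSet E s v ⊆ PrefixModule E s a l j :=
  fun _ hx => mem_prefixModule.2 (.inr ⟨i, hij, v, hv, hx⟩)

theorem prefixModule_subset_of_dom [Finite V] (hreach : ∀ v : V, ∃ p : List V, IsPath E s v p)
    (hl : IsTopoSCCList E s a l) (hl' : IsTopoSCCList E s b l') (hab : Dom E s a b)
    (hne : b ≠ a) (hx : x ∈ PrefixModule E s a l j) (hx' : x ∈ PrefixModule E s b l' k) :
    PrefixModule E s b l' k ⊆ PrefixModule E s a l j := by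
  obtain ⟨w, hw, hwb⟩ := exists_child_dom hreach hab hne
  obtain ⟨i, -, hwi⟩ := hl.exists_mem_getD hw
  have hij := hl.lt_of_mem_prefixModule hreach hwi
    (hwb.trans (hl'.prefixModule_subset_domSet hx')) hx
  exact fun y hy => domSet_subset_prefixModule hwi hij
    (hwb.trans (hl'.prefixModule_subset_domSet hy))

end PrefixModule

section ACFamily

variable {E : V → V → Prop} {s : V} {L : V → List (Set V)}

theorem prefixModule_mem_ACFamily {a : V} {j : ℕ} (hj : j ≤ (L a).length) :
    PrefixModule E s a (L a) j ∈ ACFamily E s L :=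
  ⟨a, j, hj, rfl⟩

theorem isNestingDecomp_ACFamily [Finite V] (hreach : ∀ v : V, ∃ p : List V, IsPath E s v p)
    (hL : ∀ a : V, IsTopoSCCList E s a (L a)) : IsNestingDecomp E s (ACFamily E s L) := by
  refine ⟨?_, ?_, ⟨s, _, le_rfl, ?_⟩, fun v => ⟨v, 0, zero_le, prefixModule_zero.symm⟩⟩
  · rintro _ ⟨a, j, -, rfl⟩
    exact (hL a).isModule_prefixModule hreach
  · rintro _ ⟨a, j, -, rfl⟩ _ ⟨b, k, -, rfl⟩ ⟨⟨x, hxa, hxb⟩, hab, hba⟩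
    by_cases hne : a = b
    · subst hne
      rcases le_total j k with h | h
      · exact hab (prefixModule_mono h)
      · exact hba (prefixModule_mono h)
    rcases Dom.total hreach ((hL a).prefixModule_subset_domSet hxa)
      ((hL b).prefixModule_subset_domSet hxb) with h | h
    · exact hba (prefixModule_subset_of_dom hreach (hL a) (hL b) h (Ne.symm hne) hxa hxb)
    · exact hab (prefixModule_subset_of_dom hreach (hL b) (hL a) h hne hxb hxa)
  · rw [(hL s).prefixModule_length hreach]
    exact (Set.eq_univ_of_forall (Dom.source_left E s)).symm

theorem ncard_getD_le_maxSCCSize [Finite V] (a : V) {i : ℕ} (hi : i < (L a).length) :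
    ((L a).getD i ∅).ncard ≤ MaxSCCSize L := by
  refine le_ciSup_of_le (Set.finite_range _).bddAbove a ?_
  refine le_ciSup_of_le ⟨Nat.card V, ?_⟩ i ?_
  · rintro _ ⟨i, rfl⟩
    exact ciSup_le' fun _ => Set.ncard_le_card _
  · exact le_ciSup_of_le (Set.finite_range _).bddAbove (Finset.mem_range.2 hi) le_rfl

theorem maxPartition_prefixModule_succ_subset [Finite V]
    (hreach : ∀ v : V, ∃ p : List V, IsPath E s v p)
    (hL : ∀ a : V, IsTopoSCCList E s a (L a)) {a : V} {j : ℕ} (hj : j < (L a).length) :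
    MaxPartition (ACFamily E s L) (PrefixModule E s a (L a) (j + 1)) ⊆
      insert (PrefixModule E s a (L a) j) (DomSet E s '' (L a).getD j ∅) := by
  have hprev : PrefixModule E s a (L a) j ⊂ PrefixModule E s a (L a) (j + 1) := by
    refine ⟨prefixModule_mono j.le_succ, fun h => ?_⟩
    obtain ⟨v, hv⟩ : ((L a).getD j ∅).Nonempty := by
      obtain ⟨u, hu, hS⟩ := (hL a).isSCC_getD hj
      exact ⟨u, hS ▸ ⟨hu, .refl, .refl⟩⟩
    have hv' : v ∈ PrefixModule E s a (L a) (j + 1) :=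
      domSet_subset_prefixModule hv j.lt_succ_self (Dom.refl E s v)
    exact lt_irrefl j ((hL a).lt_of_mem_prefixModule hreach hv (Dom.refl E s v) (h hv'))
  rintro H ⟨⟨b, k, hk, rfl⟩, hH, hmax⟩
  have hmax' : ∀ K ∈ ACFamily E s L, PrefixModule E s b (L b) k ⊆ K →
      K ⊂ PrefixModule E s a (L a) (j + 1) → PrefixModule E s b (L b) k = K := by
    intro K hK hHK hKM
    by_contra hne
    exact hmax ⟨K, hK, hHK.ssubset_of_ne hne, hKM⟩
  have hprevF : PrefixModule E s a (L a) j ∈ ACFamily E s L := prefixModule_mem_ACFamily hj.le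
  rcases mem_prefixModule.1 (hH.1 source_mem_prefixModule) with rfl | ⟨i, hi, w, hw, hwb⟩
  · have hkj : k ≤ j := by
      by_contra! h
      exact hH.2 (prefixModule_mono h)
    exact .inl (hmax' _ hprevF (prefixModule_mono hkj) hprev)
  · have hsub : PrefixModule E s b (L b) k ⊆ DomSet E s w :=
      fun y hy => hwb.trans ((hL b).prefixModule_subset_domSet hy)
    rcases (Nat.lt_succ_iff.1 hi).lt_or_eq with hij | rfl
    · exact .inl (hmax' _ hprevF (hsub.trans (domSet_subset_prefixModule hw hij)) hprev)
    · refine .inr ⟨w, hw, (hmax' _ ?_ hsub ⟨domSet_subset_prefixModule hw hi, fun h => ?_⟩).symm⟩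
      · rw [← (hL w).prefixModule_length hreach]
        exact prefixModule_mem_ACFamily le_rfl
      · exact ((hL a).isChild hw).not_dom_parent hreach (h source_mem_prefixModule)

theorem NDWidth_ACFamily_le [Finite V] (hreach : ∀ v : V, ∃ p : List V, IsPath E s v p)
    (hL : ∀ a : V, IsTopoSCCList E s a (L a)) :
    NDWidth (ACFamily E s L) ≤ 1 + MaxSCCSize L := by
  refine ciSup_le' fun M => ciSup_le' ?_
  rintro ⟨a, j, hj, rfl⟩
  cases j with
  | zero =>
    suffices h : MaxPartition (ACFamily E s L) (PrefixModule E s a (L a) 0) = ∅ by simp [h]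
    refine Set.eq_empty_of_forall_notMem ?_
    rintro _ ⟨⟨b, k, -, rfl⟩, hH, -⟩
    rw [prefixModule_zero, Set.ssubset_singleton_iff] at hH
    exact Set.notMem_empty b (hH ▸ source_mem_prefixModule)
  | succ j =>
    calc _ ≤ _ := Set.ncard_le_ncard
          (maxPartition_prefixModule_succ_subset hreach hL hj) (Set.toFinite _)
      _ ≤ (DomSet E s '' (L a).getD j ∅).ncard + 1 := Set.ncard_insert_le _ _
      _ ≤ ((L a).getD j ∅).ncard + 1 := by
        gcongr
        exact Set.ncard_image_le (Set.toFinite _)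
      _ ≤ 1 + MaxSCCSize L := by
        rw [add_comm]
        gcongr
        exact ncard_getD_le_maxSCCSize a hj

theorem one_add_maxSCCSize_le_NDWidth [Finite V] [Nontrivial V]
    (hreach : ∀ v : V, ∃ p : List V, IsPath E s v p)
    (hL : ∀ a : V, IsTopoSCCList E s a (L a)) {F : Set (Set V)} (hF : IsNestingDecomp E s F) :
    1 + MaxSCCSize L ≤ NDWidth F := by
  have h₁ := one_le_NDWidth hF
  have h₂ : MaxSCCSize L ≤ NDWidth F - 1 := by
    refine ciSup_le' fun a => ciSup_le' fun i => ciSup_le' fun hi => ?_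
    have := one_add_ncard_le_NDWidth hreach hF ((hL a).isSCC_getD (Finset.mem_range.1 hi))
    omega
  omega

end ACFamily

/-- the nesting width of `G` equals `1 + max{ |S^a_i| }`; in
particular the A-C family is a nesting decomposition of minimum width. -/
theorem nestingWidth_eq [Fintype V] (E : V → V → Prop) (s : V)
    (hreach : ∀ v : V, ∃ p : List V, IsPath E s v p)
    (hcard : 2 ≤ Fintype.card V)
    (L : V → List (Set V)) (hL : ∀ a : V, IsTopoSCCList E s a (L a)) :
    nestingWidth E s = 1 + MaxSCCSize L ∧
    IsNestingDecomp E s (ACFamily E s L) ∧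
    NDWidth (ACFamily E s L) = nestingWidth E s := by
  have : Nontrivial V := Fintype.one_lt_card_iff_nontrivial.1 hcard
  have hAC := isNestingDecomp_ACFamily hreach hL
  have hwidth : NDWidth (ACFamily E s L) = 1 + MaxSCCSize L :=
    (NDWidth_ACFamily_le hreach hL).antisymm (one_add_maxSCCSize_le_NDWidth hreach hL hAC)
  have hnw : nestingWidth E s = 1 + MaxSCCSize L := by
    refine le_antisymm (Nat.sInf_le ⟨_, hAC, hwidth⟩) (le_csInf ⟨_, _, hAC, hwidth⟩ ?_)
    rintro _ ⟨F, hF, rfl⟩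
    exact one_add_maxSCCSize_le_NDWidth hreach hL hF
  exact ⟨hnw, hAC, hwidth.trans hnw.symm⟩
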